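/- Fix an S-structure (𝕊, ℙ), assume X is a finite disjoint union of domains, and let v = {[f₁,D₁],…,[fₘ,Dₘ]} ∈ 𝒱_𝕊 be a vertex. Then the stabilizer (Γ_S)_v of v under the Γ_S-action has a finite-index subgroup isomorphic to the direct product of groups ∏_{i=1}^{m} 𝕊(D_i,D_i) (each 𝕊(D,D) being a group under composition by the S-structure axioms). In particular, if 𝕊(D,D) is finite for every nonempty domain D, then (Γ_S)_v is finite. -/

import Mathlib

set_option autoImplicit false

namespace GTLD

/-- A partial bijection of `X`: a functional, injective relation on `X`.
It represents a bijection between its domain and its image. -/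
structure PartialBij (X : Type*) where
  rel : X → X → Prop
  functional : ∀ ⦃x y y'⦄, rel x y → rel x y' → y = y'
  injective : ∀ ⦃x x' y⦄, rel x y → rel x' y → x = x'

namespace PartialBij

variable {X : Type*}

/-- The domain of a partial bijection. -/
def domSet (f : PartialBij X) : Set X :=
  {x | ∃ y, f.rel x y}

/-- The image of a partial bijection. -/
def imgSet (f : PartialBij X) : Set X :=
  {y | ∃ x, f.rel x y}

/-- The image of a set under a partial bijection. -/
def image (f : PartialBij X) (A : Set X) : Set X :=
  {y | ∃ x ∈ A, f.rel x y}

/-- Composition `g ∘ f` of partial bijections (first apply `f`, then `g`);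
this is the composition `g ∘ f : f⁻¹(B ∩ C) → g(B ∩ C)` of the paper. -/
def comp (g f : PartialBij X) : PartialBij X where
  rel := fun x z => ∃ y, f.rel x y ∧ g.rel y z
  functional := by
    rintro x z z' ⟨y, h1, h2⟩ ⟨y', h1', h2'⟩
    cases f.functional h1 h1'
    exact g.functional h2 h2'
  injective := by
    rintro x x' z ⟨y, h1, h2⟩ ⟨y', h1', h2'⟩
    cases g.injective h2 h2'
    exact f.injective h1 h1'

/-- The inverse of a partial bijection. -/
def inv (f : PartialBij X) : PartialBij X where
  rel := fun x y => f.rel y x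
  functional := by
    intro x y y' h h'
    exact f.injective h h'
  injective := by
    intro x x' y h h'
    exact f.functional h h'

/-- The restriction of a partial bijection to a subset. -/
def restrict (f : PartialBij X) (A : Set X) : PartialBij X where
  rel := fun x y => x ∈ A ∧ f.rel x y
  functional := by
    rintro x y y' ⟨_, h⟩ ⟨_, h'⟩
    exact f.functional h h'
  injective := by
    rintro x x' y ⟨_, h⟩ ⟨_, h'⟩
    exact f.injective h h'

/-- The identity partial bijection on a subset `A ⊆ X`. -/
def idOn (A : Set X) : PartialBij X where
  rel := fun x y => x ∈ A ∧ x = y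
  functional := by
    rintro x y y' ⟨_, h1⟩ ⟨_, h2⟩
    rw [← h1, ← h2]
  injective := by
    rintro x x' y ⟨_, h1⟩ ⟨_, h2⟩
    rw [h1, h2]

end PartialBij

variable {X : Type*}

/-- `D` is a domain for `S`: it is the domain of some element of `S`. -/
def IsDomain (S : Set (PartialBij X)) (D : Set X) : Prop :=
  ∃ s ∈ S, s.domSet = D

/-- `Y` is a finite disjoint union of domains. -/
def FinDisjUnionOfDomains (S : Set (PartialBij X)) (Y : Set X) : Prop :=
  ∃ (n : ℕ) (D : Fin n → Set X), (∀ i, IsDomain S (D i)) ∧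
    (∀ i j, i ≠ j → D i ∩ D j = ∅) ∧ (⋃ i, D i) = Y

/-- A partial bijection is locally determined by `S`: its domain and image admit
finite partitions into domains such that the restriction of the bijection to each
member of the first partition is an element of `S` mapping it bijectively onto the
corresponding member of the second. -/
def LocallyDetermined (S : Set (PartialBij X)) (f : PartialBij X) : Prop :=
  ∃ (m : ℕ) (t : Fin m → PartialBij X),
    (∀ i, t i ∈ S) ∧
    (∀ i j, i ≠ j → (t i).domSet ∩ (t j).domSet = ∅) ∧
    (∀ i j, i ≠ j → (t i).imgSet ∩ (t j).imgSet = ∅) ∧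
    (⋃ i, (t i).domSet) = f.domSet ∧
    (∀ x y, f.rel x y ↔ ∃ i, (t i).rel x y)

/-- Membership in the group `Γ_S`: a bijection of all of `X` that is
locally determined by `S`. -/
def MemGamma (S : Set (PartialBij X)) (γ : PartialBij X) : Prop :=
  γ.domSet = Set.univ ∧ γ.imgSet = Set.univ ∧ LocallyDetermined S γ

/-- `Pt` is a partition of `D` (into nonempty pieces). -/
def IsPartitionOf (Pt : Set (Set X)) (D : Set X) : Prop :=
  ∅ ∉ Pt ∧ ⋃₀ Pt = D ∧ ∀ P ∈ Pt, ∀ Q ∈ Pt, P ≠ Q → P ∩ Q = ∅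

/-- The set of domains of `S` has the compact ultrametric property:
intersecting domains are nested, and the complement of a domain is a finite
union of domains. -/
def CompactUltrametric (S : Set (PartialBij X)) : Prop :=
  (∀ D₁ D₂, IsDomain S D₁ → IsDomain S D₂ → (D₁ ∩ D₂).Nonempty →
    D₁ ⊆ D₂ ∨ D₂ ⊆ D₁) ∧
  (∀ D, IsDomain S D → ∃ (n : ℕ) (E : Fin n → Set X),
    (∀ i, IsDomain S (E i)) ∧ (⋃ i, E i) = Dᶜ)

/-- `F` is the greatest proper nonempty subdomain of `D` containing `x`. -/
def IsGreatestProperSub (S : Set (PartialBij X)) (D F : Set X) (x : X) : Prop :=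
  IsDomain S F ∧ x ∈ F ∧ F ⊂ D ∧
    ∀ F', IsDomain S F' → x ∈ F' → F' ⊂ D → F' ⊆ F

/-- `maxPart` assigns to each nonempty domain its maximal partition: the partition
into greatest proper nonempty subdomains, or `{D}` if `D` has no proper nonempty
subdomain. -/
def MaxPartSpec (S : Set (PartialBij X)) (maxPart : Set X → Set (Set X)) : Prop :=
  ∀ D, IsDomain S D → D.Nonempty →
    ((∃ F, IsDomain S F ∧ F.Nonempty ∧ F ⊂ D) →
      maxPart D = {F | ∃ x ∈ D, IsGreatestProperSub S D F x}) ∧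
    ((¬ ∃ F, IsDomain S F ∧ F.Nonempty ∧ F ⊂ D) → maxPart D = {D})

/-- An `S`-structure: a structure function `str` assigning structure sets to pairs
of nonempty domains, and a pattern function `pat` assigning sets of patterns
(finite partitions into domains) to nonempty domains, subject to the axioms
(P1)-(P5) and (S1)-(S6). -/
structure SStructure (S : Set (PartialBij X)) where
  str : Set X → Set X → Set (PartialBij X)
  pat : Set X → Set (Set (Set X))
  /-- (P1) the trivial partition is a pattern -/
  pat_trivial : ∀ D, IsDomain S D → D.Nonempty → {D} ∈ pat D
  /-- (P2) each pattern is a finite partition of `D` into domains -/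
  pat_partition : ∀ D, IsDomain S D → D.Nonempty → ∀ Pt ∈ pat D,
    Pt.Finite ∧ IsPartitionOf Pt D ∧ ∀ P ∈ Pt, IsDomain S P
  /-- (P3) restriction -/
  pat_restrict : ∀ D E, IsDomain S D → D.Nonempty → IsDomain S E → E.Nonempty →
    E ⊆ D → ∀ Pt ∈ pat D, {Q | ∃ P ∈ Pt, (P ∩ E).Nonempty ∧ Q = P ∩ E} ∈ pat E
  /-- (P4) patchwork -/
  pat_patchwork : ∀ D, IsDomain S D → D.Nonempty → ∀ Pt ∈ pat D,
    ∀ F : Set X → Set (Set X), (∀ P ∈ Pt, F P ∈ pat P) →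
    {Q | ∃ P ∈ Pt, Q ∈ F P} ∈ pat D
  /-- (P5) cofinality -/
  pat_cofinal : ∀ D, IsDomain S D → D.Nonempty →
    ∀ Pt' : Set (Set X), Pt'.Finite → IsPartitionOf Pt' D →
    (∀ P ∈ Pt', IsDomain S P) →
    ∃ Pt ∈ pat D, ∀ P ∈ Pt, ∃ P' ∈ Pt', P ⊆ P'
  /-- (S1) elements of `str D₁ D₂` lie in `S`, with domain `D₁` and image `D₂` -/
  str_mem : ∀ D₁ D₂, ∀ s ∈ str D₁ D₂, s ∈ S ∧ s.domSet = D₁ ∧ s.imgSet = D₂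
  /-- (S2) identities -/
  str_id : ∀ D, IsDomain S D → D.Nonempty → PartialBij.idOn D ∈ str D D
  /-- (S3) inverses -/
  str_inv : ∀ D₁ D₂, ∀ s ∈ str D₁ D₂, PartialBij.inv s ∈ str D₂ D₁
  /-- (S4) compositions -/
  str_comp : ∀ D₁ D₂ D₃, ∀ s₁ ∈ str D₁ D₂, ∀ s₂ ∈ str D₂ D₃,
    PartialBij.comp s₂ s₁ ∈ str D₁ D₃
  /-- (S5) generation -/
  generation : ∀ f : PartialBij X, IsDomain S f.domSet → f.domSet.Nonempty →
    LocallyDetermined S f →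
    ∃ Pt ∈ pat f.domSet, ∀ E ∈ Pt,
      f.restrict E ∈ S ∧ f.restrict E ∈ str E (f.image E)
  /-- (S6) `𝕊`-invariance of `ℙ` -/
  pat_invariant : ∀ D₁ D₂, IsDomain S D₁ → D₁.Nonempty → ∀ Pt ∈ pat D₁,
    ∀ s ∈ str D₁ D₂, {Q | ∃ P ∈ Pt, Q = PartialBij.image s P} ∈ pat D₂

/-- The maximal `S`-structure: the structure sets are all elements of `S` with the
given domain and image, and the patterns are all finite partitions into domains. -/
def IsMaximalSStructure {S : Set (PartialBij X)} (SS : SStructure S) : Prop :=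
  (∀ D₁ D₂, IsDomain S D₁ → D₁.Nonempty → IsDomain S D₂ → D₂.Nonempty →
    SS.str D₁ D₂ = {s | s ∈ S ∧ s.domSet = D₁ ∧ s.imgSet = D₂}) ∧
  (∀ D, IsDomain S D → D.Nonempty →
    SS.pat D = {Pt | Pt.Finite ∧ IsPartitionOf Pt D ∧ ∀ P ∈ Pt, IsDomain S P})

/-- `f` is (a representative of) an element `[f, D]` of `ℬ`: its domain is a
nonempty domain and it is locally determined by `S`. -/
def IsSPair (S : Set (PartialBij X)) (f : PartialBij X) : Prop :=
  IsDomain S f.domSet ∧ f.domSet.Nonempty ∧ LocallyDetermined S f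

/-- The fundamental equivalence relation on pairs: `(f, D₁) ∼ (g, D₂)` iff
`f = g ∘ h` for some `h ∈ 𝕊(D₁, D₂)`. -/
def PairRel {S : Set (PartialBij X)} (SS : SStructure S) (f g : PartialBij X) : Prop :=
  ∃ h ∈ SS.str f.domSet g.domSet, f = PartialBij.comp g h

/-- A pseudovertex: a nonempty finite set of (representatives of) elements of `ℬ`
whose images are pairwise disjoint. -/
def IsPseudovertex (S : Set (PartialBij X)) (v : Set (PartialBij X)) : Prop :=
  v.Finite ∧ v.Nonempty ∧ (∀ f ∈ v, IsSPair S f) ∧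
    ∀ f ∈ v, ∀ g ∈ v, f ≠ g → f.imgSet ∩ g.imgSet = ∅

/-- The image of a pseudovertex. -/
def PVImage (v : Set (PartialBij X)) : Set X :=
  ⋃ f ∈ v, f.imgSet

/-- Two (representative sets of) pseudovertices are equal as sets of equivalence
classes. -/
def PVEquiv {S : Set (PartialBij X)} (SS : SStructure S)
    (v w : Set (PartialBij X)) : Prop :=
  (∀ f ∈ v, ∃ g ∈ w, PairRel SS f g) ∧ (∀ g ∈ w, ∃ f ∈ v, PairRel SS f g)

/-- An expansion of a pseudovertex `v` at an element `f ∈ v`: replace `f` by the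
pieces `(f ∘ h)|_E` for `E` in a nontrivial pattern `Pt` of a domain `D̂`, where
`h ∈ 𝕊(D̂, dom f)`. -/
def Expansion {S : Set (PartialBij X)} (SS : SStructure S)
    (v v' : Set (PartialBij X)) : Prop :=
  ∃ f ∈ v, ∃ (Dh : Set X) (h : PartialBij X) (Pt : Set (Set X)),
    h ∈ SS.str Dh f.domSet ∧ Pt ∈ SS.pat Dh ∧
    (∃ P ∈ Pt, ∃ Q ∈ Pt, P ≠ Q) ∧
    v' = (v \ {f}) ∪ {g | ∃ E ∈ Pt, g = (PartialBij.comp f h).restrict E}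

/-- The partial order on pseudovertices induced by expansion (at the level of
sets of equivalence classes): `v ≤ w` iff a finite (possibly empty) sequence of
expansions leads from `v` to a pseudovertex equal to `w` as a set of classes. -/
def PVLE {S : Set (PartialBij X)} (SS : SStructure S)
    (v w : Set (PartialBij X)) : Prop :=
  ∃ w', Relation.ReflTransGen (Expansion SS) v w' ∧ PVEquiv SS w' w

/-- Strict version of `PVLE`. -/
def PVLT {S : Set (PartialBij X)} (SS : SStructure S)
    (v w : Set (PartialBij X)) : Prop :=
  PVLE SS v w ∧ ¬ PVEquiv SS v w

/-- The action of a partial bijection `s` on a pseudovertex: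
`s · {[f₁,D₁],…,[fₘ,Dₘ]} = {[s∘f₁,D₁],…,[s∘fₘ,Dₘ]}`. -/
def PVAct (s : PartialBij X) (v : Set (PartialBij X)) : Set (PartialBij X) :=
  (fun f => PartialBij.comp s f) '' v

/-- Two pseudovertices have the same type: there is a bijection between them
matching domains of the same domain type. -/
def SameType {S : Set (PartialBij X)} (SS : SStructure S)
    (v w : Set (PartialBij X)) : Prop :=
  ∃ φ : PartialBij X → PartialBij X, Set.BijOn φ v w ∧
    ∀ f ∈ v, (SS.str f.domSet (φ f).domSet).Nonempty

/-- The stabilizer of a pseudovertex `v` in `Γ_S`. -/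
def PVStab {S : Set (PartialBij X)} (SS : SStructure S)
    (v : Set (PartialBij X)) : Set (PartialBij X) :=
  {γ | MemGamma S γ ∧ PVEquiv SS (PVAct γ v) v}

/-- The subgroup of the stabilizer fixing each class `[f, D] ∈ v`. -/
def PVStabFix {S : Set (PartialBij X)} (SS : SStructure S)
    (v : Set (PartialBij X)) : Set (PartialBij X) :=
  {γ | MemGamma S γ ∧ ∀ f ∈ v, PairRel SS (PartialBij.comp γ f) f}

/-- `Pt₁ ⪯ Pt₂`: the partition `Pt₂` is obtained from `Pt₁` by replacing each
member `D` of `Pt₁` by a pattern of `D`. -/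
def PatRefines {S : Set (PartialBij X)} (SS : SStructure S)
    (Pt₁ Pt₂ : Set (Set X)) : Prop :=
  ∃ F : Set X → Set (Set X), (∀ D ∈ Pt₁, F D ∈ SS.pat D) ∧
    Pt₂ = {Q | ∃ D ∈ Pt₁, Q ∈ F D}

/-- A simple expansion: an expansion using the maximal partition. -/
def SimpleExpansion {S : Set (PartialBij X)} (SS : SStructure S)
    (maxPart : Set X → Set (Set X)) (v v' : Set (PartialBij X)) : Prop :=
  ∃ f ∈ v, ∃ (Dh : Set X) (h : PartialBij X),
    h ∈ SS.str Dh f.domSet ∧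
    (∃ P ∈ maxPart Dh, ∃ Q ∈ maxPart Dh, P ≠ Q) ∧
    v' = (v \ {f}) ∪ {g | ∃ E ∈ maxPart Dh, g = (PartialBij.comp f h).restrict E}

/-- `v'` is the result of `ℰ`-expansion from `v`. -/
def EExpansionFrom (E : PartialBij X → Set (Set (PartialBij X)))
    (v v' : Set (PartialBij X)) : Prop :=
  ∃ F : PartialBij X → Set (PartialBij X),
    (∀ f ∈ v, F f ∈ E f) ∧ v' = ⋃ f ∈ v, F f

/-- `E` is an expansion scheme: conditions (1)-(4) of Definition 6.1. -/
def IsExpansionScheme {S : Set (PartialBij X)} (SS : SStructure S)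
    (E : PartialBij X → Set (Set (PartialBij X))) : Prop :=
  ∀ f : PartialBij X, IsSPair S f →
    (∀ w ∈ E f, IsPseudovertex S w ∧ PVLE SS {f} w) ∧
    ({f} ∈ E f) ∧
    (∀ s : PartialBij X, LocallyDetermined S s → f.imgSet ⊆ s.domSet →
      (∀ w ∈ E f, ∃ w' ∈ E (PartialBij.comp s f), PVEquiv SS (PVAct s w) w') ∧
      (∀ w' ∈ E (PartialBij.comp s f), ∃ w ∈ E f, PVEquiv SS (PVAct s w) w')) ∧
    (∀ w₁ ∈ E f, ∀ w₂ ∈ E f, PVLE SS w₁ w₂ → EExpansionFrom E w₁ w₂)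

/-- An `ℰ`-chain: a strictly increasing sequence of pseudovertices, each of which
is the result of `ℰ`-expansion from the first. -/
def IsEChain {S : Set (PartialBij X)} (SS : SStructure S)
    (E : PartialBij X → Set (Set (PartialBij X)))
    (m : ℕ) (c : Fin (m + 1) → Set (PartialBij X)) : Prop :=
  (∀ i, IsPseudovertex S (c i)) ∧
  (∀ i j : Fin (m + 1), i < j → PVLT SS (c i) (c j)) ∧
  (∀ i, EExpansionFrom E (c 0) (c i))

end GTLD

namespace GTLD

theorem pb_ext {X : Type*} {f g : PartialBij X} (h : ∀ x y, f.rel x y ↔ g.rel x y) : f = g := by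
  cases f with
  | mk r _ _ =>
    cases g with
    | mk r' _ _ =>
      have : r = r' := by
        funext x y
        exact propext (h x y)
      subst this
      rfl

/-- Build `LocallyDetermined` from a family indexed by any finite type. -/
theorem ld_of {X : Type*} {S : Set (PartialBij X)} {f : PartialBij X} {ι : Type*} [Finite ι]
    (t : ι → PartialBij X) (hS : ∀ i, t i ∈ S)
    (hd : ∀ i j x y y', (t i).rel x y → (t j).rel x y' → i = j)
    (hi : ∀ i j x x' y, (t i).rel x y → (t j).rel x' y → i = j)
    (hr : ∀ x y, f.rel x y ↔ ∃ i, (t i).rel x y) : LocallyDetermined S f := by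
  obtain ⟨n, ⟨e⟩⟩ := Finite.exists_equiv_fin ι
  refine ⟨n, fun i => t (e.symm i), fun i => hS _, ?_, ?_, ?_, ?_⟩
  · intro i j hij
    by_contra hne
    obtain ⟨x, ⟨y, hy⟩, ⟨y', hy'⟩⟩ := Set.nonempty_iff_ne_empty.mpr hne
    exact hij (e.symm.injective (hd _ _ _ _ _ hy hy'))
  · intro i j hij
    by_contra hne
    obtain ⟨x, ⟨y, hy⟩, ⟨y', hy'⟩⟩ := Set.nonempty_iff_ne_empty.mpr hne
    exact hij (e.symm.injective (hi _ _ _ _ _ hy hy'))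
  · ext x
    simp only [Set.mem_iUnion]
    constructor
    · rintro ⟨i, y, hy⟩
      exact ⟨y, (hr x y).2 ⟨_, hy⟩⟩
    · rintro ⟨y, hy⟩
      obtain ⟨i, h⟩ := (hr x y).1 hy
      exact ⟨e i, y, by simpa using h⟩
  · intro x y
    rw [hr]
    constructor
    · rintro ⟨i, h⟩
      exact ⟨e i, by simpa using h⟩
    · rintro ⟨i, h⟩
      exact ⟨_, h⟩

theorem ld_elim {X : Type*} {S : Set (PartialBij X)} {f : PartialBij X}
    (h : LocallyDetermined S f) : ∃ (m : ℕ) (t : Fin m → PartialBij X), (∀ i, t i ∈ S) ∧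
    (∀ i j x y y', (t i).rel x y → (t j).rel x y' → i = j) ∧
    (∀ i j x x' y, (t i).rel x y → (t j).rel x' y → i = j) ∧
    (∀ x y, f.rel x y ↔ ∃ i, (t i).rel x y) := by
  obtain ⟨m, t, hS, hd, hi, -, hr⟩ := h
  refine ⟨m, t, hS, ?_, ?_, hr⟩
  · intro i j x y y' h h'
    by_contra hne
    have : x ∈ (t i).domSet ∩ (t j).domSet := ⟨⟨y, h⟩, ⟨y', h'⟩⟩
    rw [hd i j hne] at this
    exact this
  · intro i j x x' y h h'
    by_contra hne
    have : y ∈ (t i).imgSet ∩ (t j).imgSet := ⟨⟨x, h⟩, ⟨x', h'⟩⟩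
    rw [hi i j hne] at this
    exact this

theorem ld_inv {X : Type*} {S : Set (PartialBij X)}
    (hinv : ∀ f ∈ S, PartialBij.inv f ∈ S) {f : PartialBij X}
    (h : LocallyDetermined S f) : LocallyDetermined S f.inv := by
  obtain ⟨m, t, hS, hd, hi, hr⟩ := ld_elim h
  exact ld_of (fun i => (t i).inv) (fun i => hinv _ (hS i))
    (fun i j x y y' h h' => hi i j y y' x h h')
    (fun i j x x' y h h' => hd i j y x x' h h') (fun x y => hr y x)

theorem ld_comp {X : Type*} {S : Set (PartialBij X)}
    (hcomp : ∀ f ∈ S, ∀ g ∈ S, PartialBij.comp g f ∈ S) {f g : PartialBij X}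
    (hf : LocallyDetermined S f) (hg : LocallyDetermined S g) :
    LocallyDetermined S (g.comp f) := by
  obtain ⟨m, t, hS, hd, hi, hr⟩ := ld_elim hf
  obtain ⟨n, u, hS', hd', hi', hr'⟩ := ld_elim hg
  refine ld_of (ι := Fin m × Fin n) (fun p => (u p.2).comp (t p.1))
    (fun p => hcomp _ (hS _) _ (hS' _)) ?_ ?_ ?_
  · rintro ⟨i, k⟩ ⟨j, l⟩ x y y' ⟨z, h1, h2⟩ ⟨z', h1', h2'⟩
    have hij := hd i j x z z' h1 h1'
    subst hij
    have hz := (t i).functional h1 h1'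
    subst hz
    rw [hd' k l z y y' h2 h2']
  · rintro ⟨i, k⟩ ⟨j, l⟩ x x' y ⟨z, h1, h2⟩ ⟨z', h1', h2'⟩
    have hij := hi' k l z z' y h2 h2'
    subst hij
    have hz := (u k).injective h2 h2'
    subst hz
    rw [hi i j x x' z h1 h1']
  · intro x y
    constructor
    · rintro ⟨z, h1, h2⟩
      obtain ⟨i, h1⟩ := (hr _ _).1 h1
      obtain ⟨j, h2⟩ := (hr' _ _).1 h2
      exact ⟨(i, j), z, h1, h2⟩
    · rintro ⟨p, z, h1, h2⟩
      exact ⟨z, (hr _ _).2 ⟨_, h1⟩, (hr' _ _).2 ⟨_, h2⟩⟩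

theorem ld_mem {X : Type*} {S : Set (PartialBij X)} {f : PartialBij X} (h : f ∈ S) :
    LocallyDetermined S f :=
  ld_of (ι := Unit) (fun _ => f) (fun _ => h) (fun _ _ _ _ _ _ _ => rfl)
    (fun _ _ _ _ _ _ _ => rfl) (fun x y => ⟨fun h => ⟨(), h⟩, fun ⟨_, h⟩ => h⟩)

theorem ld_union {X : Type*} {S : Set (PartialBij X)} {f : PartialBij X} {ι : Type*} [Finite ι]
    (t : ι → PartialBij X) (hS : ∀ i, LocallyDetermined S (t i))
    (hd : ∀ i j x y y', (t i).rel x y → (t j).rel x y' → i = j)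
    (hi : ∀ i j x x' y, (t i).rel x y → (t j).rel x' y → i = j)
    (hr : ∀ x y, f.rel x y ↔ ∃ i, (t i).rel x y) : LocallyDetermined S f := by
  choose m u hS' hd' hi' hr' using fun i => ld_elim (hS i)
  refine ld_of (ι := Σ i, Fin (m i)) (fun p => u p.1 p.2) (fun p => hS' _ _) ?_ ?_ ?_
  · rintro ⟨i, k⟩ ⟨j, l⟩ x y y' h h'
    have hij := hd i j x y y' ((hr' _ _ _).2 ⟨_, h⟩) ((hr' _ _ _).2 ⟨_, h'⟩)
    subst hij
    rw [hd' i k l x y y' h h']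
  · rintro ⟨i, k⟩ ⟨j, l⟩ x x' y h h'
    have hij := hi i j x x' y ((hr' _ _ _).2 ⟨_, h⟩) ((hr' _ _ _).2 ⟨_, h'⟩)
    subst hij
    rw [hi' i k l x x' y h h']
  · intro x y
    rw [hr]
    constructor
    · rintro ⟨i, h⟩
      obtain ⟨j, h⟩ := (hr' _ _ _).1 h
      exact ⟨⟨i, j⟩, h⟩
    · rintro ⟨⟨i, j⟩, h⟩
      exact ⟨i, (hr' _ _ _).2 ⟨j, h⟩⟩

theorem dom_comp_total {X : Type*} {γ f : PartialBij X} (h : γ.domSet = Set.univ) :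
    (γ.comp f).domSet = f.domSet := by
  ext x
  constructor
  · rintro ⟨y, z, h1, h2⟩
    exact ⟨z, h1⟩
  · rintro ⟨z, h1⟩
    have : z ∈ γ.domSet := by rw [h]; trivial
    obtain ⟨y, hy⟩ := this
    exact ⟨y, z, h1, hy⟩

/-- If `γ ∘ f = f ∘ h` with `h` having image in `dom f`, then `h = f⁻¹ ∘ γ ∘ f`. -/
theorem eq_conj {X : Type*} {γ f h : PartialBij X} (hi : h.imgSet = f.domSet)
    (he : γ.comp f = f.comp h) : h = f.inv.comp (γ.comp f) := by
  rw [he]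
  apply pb_ext
  intro x y
  constructor
  · intro hxy
    have : y ∈ f.domSet := by rw [← hi]; exact ⟨x, hxy⟩
    obtain ⟨z, hz⟩ := this
    exact ⟨z, ⟨y, hxy, hz⟩, hz⟩
  · rintro ⟨z, ⟨w, h1, h2⟩, h3⟩
    cases f.injective h2 h3
    exact h1

/-- The bijection glued from the pieces `f ∘ h_f ∘ f⁻¹`. -/
def glue {X : Type*} (v : Set (PartialBij X))
    (hdis : ∀ f ∈ v, ∀ g ∈ v, ∀ x x' y, f.rel x y → g.rel x' y → f = g)
    (h : {f : PartialBij X // f ∈ v} → PartialBij X) : PartialBij X where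
  rel := fun x y => ∃ f : {f : PartialBij X // f ∈ v}, (f.1.comp ((h f).comp f.1.inv)).rel x y
  functional := by
    rintro x y y' ⟨f, h1⟩ ⟨g, h2⟩
    have : f = g := by
      obtain ⟨a, ⟨b, hb, _⟩, _⟩ := h1
      obtain ⟨a', ⟨b', hb', _⟩, _⟩ := h2
      exact Subtype.ext (hdis _ f.2 _ g.2 _ _ _ hb hb')
    subst this
    exact PartialBij.functional _ h1 h2
  injective := by
    rintro x x' y ⟨f, h1⟩ ⟨g, h2⟩
    have : f = g := by
      obtain ⟨a, _, hb⟩ := h1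
      obtain ⟨a', _, hb'⟩ := h2
      exact Subtype.ext (hdis _ f.2 _ g.2 _ _ _ hb hb')
    subst this
    exact PartialBij.injective _ h1 h2

/-- the stabilizer of a vertex `v = {[f₁,D₁],…,[fₘ,Dₘ]}` in `Γ_S`
contains, with finite index, the subgroup of elements fixing each class
`[fᵢ,Dᵢ]`, and the latter is isomorphic (multiplicatively) to the product
`∏ᵢ 𝕊(Dᵢ,Dᵢ)`.  In particular, if each `𝕊(D,D)` is finite then the stabilizer
is finite. -/
theorem statement16 {X : Type*} (S : Set (PartialBij X))
    (hcomp : ∀ f ∈ S, ∀ g ∈ S, PartialBij.comp g f ∈ S)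
    (hinv : ∀ f ∈ S, PartialBij.inv f ∈ S)
    (SS : SStructure S)
    (hX : FinDisjUnionOfDomains S Set.univ)
    (v : Set (PartialBij X)) (hv : IsPseudovertex S v)
    (hvim : PVImage v = Set.univ) :
    PVStabFix SS v ⊆ PVStab SS v ∧
    (∃ T : Set (PartialBij X), T.Finite ∧ T ⊆ PVStab SS v ∧
      ∀ γ ∈ PVStab SS v, ∃ t ∈ T, ∃ δ ∈ PVStabFix SS v,
        γ = PartialBij.comp t δ) ∧
    (∃ e : {γ : PartialBij X // γ ∈ PVStabFix SS v} ≃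
        ((f : {f : PartialBij X // f ∈ v}) →
          {h : PartialBij X // h ∈ SS.str f.1.domSet f.1.domSet}),
      ∀ (γ δ : {γ : PartialBij X // γ ∈ PVStabFix SS v})
        (hm : PartialBij.comp γ.1 δ.1 ∈ PVStabFix SS v)
        (f : {f : PartialBij X // f ∈ v}),
        (e ⟨PartialBij.comp γ.1 δ.1, hm⟩ f : PartialBij X) =
          PartialBij.comp (e γ f : PartialBij X) (e δ f : PartialBij X)) ∧
    ((∀ D : Set X, IsDomain S D → D.Nonempty → (SS.str D D).Finite) →
      (PVStab SS v).Finite) := by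
  obtain ⟨hfin, hne, hpair, hdis0⟩ := hv
  have hdis : ∀ f ∈ v, ∀ g ∈ v, ∀ x x' y, f.rel x y → g.rel x' y → f = g := by
    intro f hf g hg x x' y h h'
    by_contra hfg
    have : y ∈ f.imgSet ∩ g.imgSet := ⟨⟨x, h⟩, ⟨x', h'⟩⟩
    rw [hdis0 f hf g hg hfg] at this
    exact this
  have hcov : ∀ y, ∃ f ∈ v, ∃ x, f.rel x y := by
    intro y
    have : y ∈ PVImage v := by rw [hvim]; trivial
    simp only [PVImage, Set.mem_iUnion] at this
    obtain ⟨f, hf, x, hx⟩ := this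
    exact ⟨f, hf, x, hx⟩
  haveI : Finite {f : PartialBij X // f ∈ v} := hfin
  have hsub : PVStabFix SS v ⊆ PVStab SS v := by
    rintro γ ⟨hγ, h⟩
    refine ⟨hγ, ?_, ?_⟩
    · rintro _ ⟨f, hf, rfl⟩
      exact ⟨f, hf, h f hf⟩
    · intro g hg
      exact ⟨_, ⟨g, hg, rfl⟩, h g hg⟩
  -- the finite set of coset representatives
  have hT : ∃ T : Set (PartialBij X), T.Finite ∧ T ⊆ PVStab SS v ∧
      ∀ γ ∈ PVStab SS v, ∃ t ∈ T, ∃ δ ∈ PVStabFix SS v, γ = PartialBij.comp t δ := by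
    have hσ : ∀ γ : {γ // γ ∈ PVStab SS v}, ∃ σ : {f // f ∈ v} → {f // f ∈ v},
        ∀ f, PairRel SS (PartialBij.comp γ.1 f.1) (σ f).1 := by
      rintro ⟨γ, hγ, h1, h2⟩
      have : ∀ f : {f // f ∈ v}, ∃ g : {f // f ∈ v}, PairRel SS (PartialBij.comp γ f.1) g.1 := by
        intro f
        obtain ⟨g, hg, h⟩ := h1 _ ⟨f.1, f.2, rfl⟩
        exact ⟨⟨g, hg⟩, h⟩
      choose σ hσ using this
      exact ⟨σ, hσ⟩
    choose σ hσ using hσ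
    choose r hr using fun s : Set.range σ => s.2
    refine ⟨Set.range (fun s => (r s).1), Set.finite_range _, ?_, ?_⟩
    · rintro _ ⟨s, rfl⟩
      exact (r s).2
    · intro γ hγ
      set s : Set.range σ := ⟨σ ⟨γ, hγ⟩, _, rfl⟩ with hs
      refine ⟨(r s).1, ⟨s, rfl⟩, (r s).1.inv.comp γ, ?_, ?_⟩
      · obtain ⟨td, ti, tl⟩ := (r s).2.1
        obtain ⟨gd, gi, gl⟩ := hγ.1
        have hδd : ((r s).1.inv.comp γ).domSet = Set.univ := by
          rw [dom_comp_total (by exact ti), gd]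
        refine ⟨⟨hδd, ?_, ld_comp hcomp gl (ld_inv hinv tl)⟩, ?_⟩
        · apply Set.eq_univ_of_forall
          intro y
          have : y ∈ (r s).1.domSet := by rw [td]; trivial
          obtain ⟨z, hz⟩ := this
          have : z ∈ γ.imgSet := by rw [gi]; trivial
          obtain ⟨x, hx⟩ := this
          exact ⟨x, z, hx, hz⟩
        · intro f hf
          obtain ⟨h, hh, he⟩ := hσ ⟨γ, hγ⟩ ⟨f, hf⟩
          obtain ⟨k, hk, ke⟩ := hσ (r s) ⟨f, hf⟩
          rw [hr s] at hk ke
          simp only [hs] at hk ke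
          rw [dom_comp_total gd] at hh
          rw [dom_comp_total (by exact td)] at hk
          refine ⟨k.inv.comp h, ?_, ?_⟩
          · rw [dom_comp_total hδd]
            exact SS.str_comp _ _ _ _ hh _ (SS.str_inv _ _ _ hk)
          · have he' : ∀ x y, (γ.comp f).rel x y ↔ _ := fun x y => by rw [he]
            have ke' : ∀ x y, ((r s).1.comp f).rel x y ↔ _ := fun x y => by rw [ke]
            apply pb_ext
            intro x y
            constructor
            · rintro ⟨a, h1, b, h2, h3⟩
              obtain ⟨c, h4, h5⟩ := (he' x b).1 ⟨a, h1, h2⟩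
              obtain ⟨f', hf', x', hx'⟩ := hcov y
              have hkd := (SS.str_mem _ _ _ hk).2.2
              have : c ∈ k.imgSet := by rw [hkd]; exact ⟨b, h5⟩
              obtain ⟨d, hd⟩ := this
              obtain ⟨y', h6, h7⟩ := (ke' d b).2 ⟨c, hd, h5⟩
              cases PartialBij.injective _ h7 h3
              exact ⟨d, ⟨c, h4, hd⟩, h6⟩
            · rintro ⟨d, ⟨c, h4, hd⟩, h6⟩
              have : d ∈ ((r s).1.comp f).domSet := by
                rw [dom_comp_total (by exact td)]; exact ⟨y, h6⟩
              obtain ⟨b, hb⟩ := this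
              obtain ⟨c', hc', h5⟩ := (ke' d b).1 hb
              cases k.functional hd hc'
              obtain ⟨y', h6', h7⟩ := hb
              cases f.functional h6 h6'
              obtain ⟨a, ha, hab⟩ := (he' x b).2 ⟨c, h4, h5⟩
              exact ⟨a, ha, b, hab, h7⟩
      · have ti := (r s).2.1.2.1
        apply pb_ext
        intro x y
        constructor
        · intro h
          have : y ∈ (r s).1.imgSet := by rw [ti]; trivial
          obtain ⟨z, hz⟩ := this
          exact ⟨z, ⟨y, h, hz⟩, hz⟩
        · rintro ⟨z, ⟨w, h1, h2⟩, h3⟩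
          cases (r s).1.functional (show (r s).1.rel z w from h2) h3
          exact h1
  -- the isomorphism
  have hconj : ∀ γ ∈ PVStabFix SS v, ∀ f ∈ v,
      f.inv.comp (γ.comp f) ∈ SS.str f.domSet f.domSet ∧
      γ.comp f = f.comp (f.inv.comp (γ.comp f)) := by
    rintro γ ⟨hγ, h⟩ f hf
    obtain ⟨k, hk, he⟩ := h f hf
    rw [dom_comp_total hγ.1] at hk
    have := eq_conj (SS.str_mem _ _ _ hk).2.2 he
    rw [← this]
    exact ⟨hk, he⟩
  have hglue : ∀ h : (f : {f : PartialBij X // f ∈ v}) →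
      {h : PartialBij X // h ∈ SS.str f.1.domSet f.1.domSet}, ∀ f : {f : PartialBij X // f ∈ v},
      (glue v hdis (fun f => (h f).1)).comp f.1 = f.1.comp (h f).1 := by
    intro h f
    have hd := (SS.str_mem _ _ _ (h f).2).2.1
    apply pb_ext
    intro x y
    constructor
    · rintro ⟨z, h1, g, w, ⟨u, h2, h3⟩, h4⟩
      have : f = g := Subtype.ext (hdis _ f.2 _ g.2 _ _ _ h1 h2)
      subst this
      cases f.1.injective h1 h2
      exact ⟨w, h3, h4⟩
    · rintro ⟨w, h3, h4⟩
      have : x ∈ f.1.domSet := by rw [← hd]; exact ⟨w, h3⟩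
      obtain ⟨z, hz⟩ := this
      exact ⟨z, hz, f, w, ⟨x, hz, h3⟩, h4⟩
  have hgmem : ∀ h : (f : {f : PartialBij X // f ∈ v}) →
      {h : PartialBij X // h ∈ SS.str f.1.domSet f.1.domSet},
      glue v hdis (fun f => (h f).1) ∈ PVStabFix SS v := by
    intro h
    have hd : (glue v hdis (fun f => (h f).1)).domSet = Set.univ := by
      apply Set.eq_univ_of_forall
      intro x
      obtain ⟨f, hf, z, hz⟩ := hcov x
      obtain ⟨-, hd, hi⟩ := SS.str_mem _ _ _ (h ⟨f, hf⟩).2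
      have : z ∈ (h ⟨f, hf⟩).1.domSet := by rw [hd]; exact ⟨x, hz⟩
      obtain ⟨w, hw⟩ := this
      have : w ∈ f.domSet := by
        change _ = f.domSet at hi
        rw [← hi]; exact ⟨z, hw⟩
      obtain ⟨y, hy⟩ := this
      exact ⟨y, ⟨f, hf⟩, w, ⟨z, hz, hw⟩, hy⟩
    refine ⟨⟨hd, ?_, ?_⟩, ?_⟩
    · apply Set.eq_univ_of_forall
      intro y
      obtain ⟨f, hf, w, hw⟩ := hcov y
      obtain ⟨-, hd, hi⟩ := SS.str_mem _ _ _ (h ⟨f, hf⟩).2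
      have : w ∈ (h ⟨f, hf⟩).1.imgSet := by rw [hi]; exact ⟨y, hw⟩
      obtain ⟨z, hz⟩ := this
      have : z ∈ f.domSet := by
        change _ = f.domSet at hd
        rw [← hd]; exact ⟨w, hz⟩
      obtain ⟨x, hx⟩ := this
      exact ⟨x, ⟨f, hf⟩, w, ⟨z, hx, hz⟩, hw⟩
    · refine ld_union (fun f : {f : PartialBij X // f ∈ v} =>
        f.1.comp ((h f).1.comp f.1.inv)) ?_ ?_ ?_ (fun x y => Iff.rfl)
      · intro f
        have hl := (hpair f.1 f.2).2.2
        exact ld_comp hcomp (ld_comp hcomp (ld_inv hinv hl)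
          (ld_mem (SS.str_mem _ _ _ (h f).2).1)) hl
      · rintro f g x y y' ⟨a, ⟨b, hb, _⟩, _⟩ ⟨a', ⟨b', hb', _⟩, _⟩
        exact Subtype.ext (hdis _ f.2 _ g.2 _ _ _ hb hb')
      · rintro f g x x' y ⟨a, _, hb⟩ ⟨a', _, hb'⟩
        exact Subtype.ext (hdis _ f.2 _ g.2 _ _ _ hb hb')
    · intro f hf
      refine ⟨(h ⟨f, hf⟩).1, ?_, hglue h ⟨f, hf⟩⟩
      rw [dom_comp_total hd]
      exact (h ⟨f, hf⟩).2
  have he : ∃ e : {γ : PartialBij X // γ ∈ PVStabFix SS v} ≃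
        ((f : {f : PartialBij X // f ∈ v}) →
          {h : PartialBij X // h ∈ SS.str f.1.domSet f.1.domSet}),
      ∀ (γ δ : {γ : PartialBij X // γ ∈ PVStabFix SS v})
        (hm : PartialBij.comp γ.1 δ.1 ∈ PVStabFix SS v)
        (f : {f : PartialBij X // f ∈ v}),
        (e ⟨PartialBij.comp γ.1 δ.1, hm⟩ f : PartialBij X) =
          PartialBij.comp (e γ f : PartialBij X) (e δ f : PartialBij X) := by
    refine ⟨⟨fun γ f => ⟨f.1.inv.comp (γ.1.comp f.1), (hconj γ.1 γ.2 f.1 f.2).1⟩,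
      fun h => ⟨glue v hdis (fun f => (h f).1), hgmem h⟩, ?_, ?_⟩, ?_⟩
    · rintro ⟨γ, hγ⟩
      apply Subtype.ext
      apply pb_ext
      intro x y
      constructor
      · rintro ⟨f, w, ⟨z, h1, u, ⟨t, h2, h3⟩, h4⟩, h5⟩
        cases f.1.functional h1 h2
        cases f.1.functional h4 h5
        exact h3
      · intro h
        obtain ⟨f, hf, z, hz⟩ := hcov x
        have : (γ.comp f).rel z y := ⟨x, hz, h⟩
        rw [(hconj γ hγ f hf).2] at this
        obtain ⟨w, h1, h2⟩ := this
        exact ⟨⟨f, hf⟩, w, ⟨z, hz, h1⟩, h2⟩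
    · intro h
      funext f
      exact Subtype.ext (eq_conj (SS.str_mem _ _ _ (h f).2).2.2 (hglue h f)).symm
    · intro γ δ hm f
      have hδ := (hconj δ.1 δ.2 f.1 f.2).2
      apply pb_ext
      intro x y
      constructor
      · rintro ⟨z, ⟨a, h1, b, h2, h3⟩, h4⟩
        have : (δ.1.comp f.1).rel x b := ⟨a, h1, h2⟩
        rw [hδ] at this
        obtain ⟨w, h5, h6⟩ := this
        exact ⟨w, h5, z, ⟨b, h6, h3⟩, h4⟩
      · rintro ⟨w, ⟨b, ⟨a, h1, h2⟩, h5⟩, z, ⟨b', h6, h3⟩, h4⟩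
        cases f.1.functional h5 h6
        exact ⟨z, ⟨a, h1, b, h2, h3⟩, h4⟩
  refine ⟨hsub, hT, he, ?_⟩
  intro hF
  obtain ⟨e, -⟩ := he
  obtain ⟨T, hTf, -, hTc⟩ := hT
  have hfix : (PVStabFix SS v).Finite := by
    haveI : ∀ f : {f : PartialBij X // f ∈ v},
        Finite {h : PartialBij X // h ∈ SS.str f.1.domSet f.1.domSet} := fun f =>
      hF _ (hpair f.1 f.2).1 (hpair f.1 f.2).2.1
    exact Finite.of_equiv _ e.symm
  refine (hTf.image2 PartialBij.comp hfix).subset ?_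
  intro γ hγ
  obtain ⟨t, ht, δ, hδ, rfl⟩ := hTc γ hγ
  exact ⟨t, ht, δ, hδ, rfl⟩

end GTLD
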